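/- Let k ≥ 2 and n₁ ≥ n₂ ≥ ⋯ ≥ n_k ≥ 1. The cover pebbling number of the complete multipartite graph K_{n₁,…,n_k} equals 4n₁ + 2n₂ + ⋯ + 2n_k − 3. -/

import Mathlib

/-- A single pebbling move on a graph `G`: remove two pebbles from a vertex `u`
(which must carry at least two pebbles) and add one pebble to a vertex `v`
adjacent to `u`. -/
def SimpleGraph.PebblingMove {V : Type*} (G : SimpleGraph V) (p q : V → ℕ) : Prop :=
  ∃ u v : V, G.Adj u v ∧ 2 ≤ p u ∧
    q u = p u - 2 ∧ q v = p v + 1 ∧ ∀ x : V, x ≠ u → x ≠ v → q x = p x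

/-- A distribution `p` is `w`-solvable if some finite sequence of pebbling moves
starting from `p` reaches a `w`-cover, i.e. a distribution `q` with `q v ≥ w v`
for every vertex `v`. -/
def SimpleGraph.WSolvable {V : Type*} (G : SimpleGraph V) (w p : V → ℕ) : Prop :=
  ∃ q : V → ℕ, Relation.ReflTransGen G.PebblingMove p q ∧ ∀ v : V, w v ≤ q v

/-- The `w`-cover pebbling number of `G`: the least `n` such that every
distribution of size `n` (total number of pebbles `n`) is `w`-solvable. -/
noncomputable def SimpleGraph.coverPebblingNumber {V : Type*} (G : SimpleGraph V) [Fintype V]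
    (w : V → ℕ) : ℕ :=
  sInf {n | ∀ p : V → ℕ, (∑ v, p v) = n → G.WSolvable w p}

namespace SimpleGraph

section Pebbling

variable {V : Type*} {G : SimpleGraph V}

theorem WSolvable.of_reflTransGen {w p q : V → ℕ}
    (hpq : Relation.ReflTransGen G.PebblingMove p q) (hq : G.WSolvable w q) :
    G.WSolvable w p := by
  obtain ⟨r, hr, hw⟩ := hq
  exact ⟨r, hpq.trans hr, hw⟩

theorem pebblingMove_of_adj [DecidableEq V] {u v : V} (huv : G.Adj u v) {p : V → ℕ}
    (hu : 2 ≤ p u) :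
    G.PebblingMove p (Function.update (Function.update p u (p u - 2)) v (p v + 1)) := by
  have := huv.ne
  refine ⟨u, v, huv, hu, ?_, ?_, ?_⟩ <;> grind

/-- Along a path `u, x, v`, four pebbles of `u` can be turned into one pebble on `v`. -/
theorem reflTransGen_pebblingMove_of_adj_adj [DecidableEq V] {u x v : V} (hux : G.Adj u x)
    (hxv : G.Adj x v) (huv : u ≠ v) {p : V → ℕ} (hu : 4 ≤ p u) :
    Relation.ReflTransGen G.PebblingMove p
      (Function.update (Function.update p u (p u - 4)) v (p v + 1)) := by
  have h₁ := hux.ne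
  have h₂ := hxv.ne
  have step₁ : G.PebblingMove p
      (Function.update (Function.update p u (p u - 2)) x (p x + 1)) :=
    pebblingMove_of_adj hux (by omega)
  have step₂ : G.PebblingMove (Function.update (Function.update p u (p u - 2)) x (p x + 1))
      (Function.update (Function.update p u (p u - 4)) x (p x + 2)) := by
    refine ⟨u, x, hux, ?_, ?_, ?_, ?_⟩ <;> grind
  have step₃ : G.PebblingMove (Function.update (Function.update p u (p u - 4)) x (p x + 2))
      (Function.update (Function.update p u (p u - 4)) v (p v + 1)) := by
    refine ⟨x, v, hxv, ?_, ?_, ?_, ?_⟩ <;> grind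
  exact ((Relation.ReflTransGen.single step₁).tail step₂).tail step₃

theorem PebblingMove.sum_mul_le [Fintype V] {c : V → ℕ}
    (hc : ∀ u v, G.Adj u v → c v ≤ 2 * c u) {p q : V → ℕ} (h : G.PebblingMove p q) :
    ∑ x, c x * q x ≤ ∑ x, c x * p x := by
  classical
  obtain ⟨u, v, huv, hu, hqu, hqv, hq⟩ := h
  have hne := huv.ne
  have key : ∑ x, (c x * q x + if x = u then 2 * c u else 0) =
      ∑ x, (c x * p x + if x = v then c v else 0) := by
    refine Finset.sum_congr rfl fun x _ => ?_
    by_cases hxu : x = u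
    · subst hxu
      obtain ⟨m, hm⟩ := Nat.exists_eq_add_of_le hu
      rw [hqu, hm]
      simp [hne]
      ring
    · by_cases hxv : x = v
      · subst hxv
        rw [hqv]
        simp [hxu]
        ring
      · simp [hxu, hxv, hq x hxu hxv]
  simp only [Finset.sum_add_distrib, Finset.sum_ite_eq', Finset.mem_univ, if_true] at key
  have := hc u v huv
  omega

theorem WSolvable.sum_mul_le [Fintype V] {c : V → ℕ}
    (hc : ∀ u v, G.Adj u v → c v ≤ 2 * c u) {w p : V → ℕ} (h : G.WSolvable w p) :
    ∑ x, c x * w x ≤ ∑ x, c x * p x := by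
  obtain ⟨q, hpq, hw⟩ := h
  have hle : ∑ x, c x * q x ≤ ∑ x, c x * p x := by
    clear hw
    induction hpq with
    | refl => exact le_rfl
    | tail _ hmove ih => exact (hmove.sum_mul_le hc).trans ih
  exact (Finset.sum_le_sum fun x _ => Nat.mul_le_mul_left _ (hw x)).trans hle

end Pebbling

theorem sum_erase_update_update_add {V : Type*} [DecidableEq V] {U : Finset V} {p : V → ℕ}
    {f t : V} (hf : f ∈ U) (ht : t ∈ U) (hft : f ≠ t) (hpt : p t = 0) {d m : ℕ}
    (hd : d ≤ p f) :
    ∑ v ∈ U.erase t, Function.update (Function.update p f (p f - d)) t m v + d =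
      ∑ v ∈ U, p v := by
  have hfe : f ∈ U.erase t := Finset.mem_erase.2 ⟨hft, hf⟩
  rw [← Finset.add_sum_erase U p ht, ← Finset.add_sum_erase _ p hfe,
    ← Finset.add_sum_erase _ _ hfe]
  have hrest : ∑ v ∈ (U.erase t).erase f,
      Function.update (Function.update p f (p f - d)) t m v =
      ∑ v ∈ (U.erase t).erase f, p v := by
    refine Finset.sum_congr rfl fun v hv => ?_
    simp only [Finset.mem_erase] at hv
    simp [hv.1, hv.2.1]
  rw [hrest, Function.update_of_ne hft, Function.update_self]
  omega

/-- The vertices outside `U` are already covered, and the pebbles in `U` suffice to cover `U`. -/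
theorem wSolvable_completeMultipartiteGraph_of_le {ι : Type*} [DecidableEq ι] [Nontrivial ι]
    {α : ι → Type*} [∀ i, DecidableEq (α i)] [∀ i, Nonempty (α i)]
    (U : Finset (Σ i, α i)) (p : (Σ i, α i) → ℕ) (hout : ∀ v ∉ U, 1 ≤ p v)
    (hU : ∀ i, 2 * (U.filter (·.1 = i)).card + 2 * U.card ≤ 3 + ∑ v ∈ U, p v) :
    (completeMultipartiteGraph α).WSolvable (fun _ => 1) p := by
  induction hn : U.card generalizing U p with
  | zero =>
    rw [Finset.card_eq_zero] at hn
    exact ⟨p, .refl, fun v => hout v (by simp [hn])⟩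
  | succ m ih =>
    have hcard : ∀ t ∈ U, (U.erase t).card = m := fun t ht => by
      rw [Finset.card_erase_of_mem ht, hn]; rfl
    have hfilter : ∀ t i, ((U.erase t).filter (·.1 = i)).card ≤
        (U.filter (·.1 = i)).card := fun t i =>
      Finset.card_le_card (Finset.filter_subset_filter _ (Finset.erase_subset _ _))
    by_cases hsmall : ∃ v ∈ U, 1 ≤ p v ∧ p v ≤ 2
    · obtain ⟨v, hv, h1, h2⟩ := hsmall
      refine ih (U.erase v) p (fun x hx => ?_) (fun i => ?_) (hcard v hv)
      · by_cases hxv : x = v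
        · rwa [hxv]
        · exact hout x (by simpa [hxv] using hx)
      · have hsum := Finset.add_sum_erase U p hv
        have := hfilter v i
        have := hU i
        have := hcard v hv
        omega
    push Not at hsmall
    by_cases hthin : ∃ t ∈ U, p t = 0
    swap
    · push Not at hthin
      refine ⟨p, .refl, fun v => ?_⟩
      by_cases hv : v ∈ U
      · exact Nat.one_le_iff_ne_zero.2 (hthin v hv)
      · exact hout v hv
    by_cases hadj : ∃ t ∈ U, ∃ f ∈ U, p t = 0 ∧ 3 ≤ p f ∧ f.1 ≠ t.1
    · obtain ⟨t, ht, f, hf, hpt, hpf, hft⟩ := hadj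
      have hne : f ≠ t := fun h => hft (congrArg Sigma.fst h)
      have hG : (completeMultipartiteGraph α).Adj f t := hft
      refine .of_reflTransGen (.single (pebblingMove_of_adj hG (by omega)))
        (ih (U.erase t) _ (fun x hx => ?_) (fun i => ?_) (hcard t ht))
      · grind
      · have hsum := sum_erase_update_update_add hf ht hne hpt (d := 2) (m := p t + 1) (by omega)
        have := hfilter t i
        have := hU i
        have := hcard t ht
        omega
    push Not at hadj
    obtain ⟨t, ht, hpt⟩ := hthin
    have hpos : 0 < ∑ v ∈ U, p v := by
      have : 0 < (U.filter (·.1 = t.1)).card := Finset.card_pos.2 ⟨t, by simp [ht]⟩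
      have := hU t.1
      omega
    obtain ⟨f, hf, hpf⟩ := Finset.exists_ne_zero_of_sum_ne_zero hpos.ne'
    have hpf3 : 3 ≤ p f := hsmall f hf (by omega)
    have hft := hadj t ht f hf hpt hpf3
    have hpart : ∀ v ∈ U, v.1 = t.1 := fun v hv => by
      by_cases hv0 : p v = 0
      · exact (hadj v hv f hf hv0 hpf3).symm.trans hft
      · exact hadj t ht v hv hpt (hsmall v hv (by omega))
    have hbound := hU t.1
    rw [Finset.filter_true_of_mem hpart] at hbound
    by_cases hfat : ∃ g ∈ U, 5 ≤ p g
    · obtain ⟨g, hg, hpg⟩ := hfat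
      have hgt : g ≠ t := by rintro rfl; omega
      obtain ⟨j, hj⟩ := exists_ne t.1
      obtain ⟨a⟩ := (inferInstance : Nonempty (α j))
      have hgx : (completeMultipartiteGraph α).Adj g ⟨j, a⟩ := fun h =>
        hj (h.symm.trans (hpart g hg))
      have hxt : (completeMultipartiteGraph α).Adj ⟨j, a⟩ t := hj
      refine .of_reflTransGen (reflTransGen_pebblingMove_of_adj_adj hgx hxt hgt (by omega))
        (ih (U.erase t) _ (fun x hx => ?_) (fun i => ?_) (hcard t ht))
      · grind
      · have hsum := sum_erase_update_update_add hg ht hgt hpt (d := 4) (m := p t + 1) (by omega)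
        have := Finset.card_filter_le (U.erase t) (·.1 = i)
        have := hcard t ht
        omega
    · push Not at hfat
      have hle : ∑ v ∈ U.erase t, p v ≤ (U.erase t).card • 4 :=
        Finset.sum_le_card_nsmul _ _ _ fun v hv =>
          Nat.le_of_lt_succ (hfat v (Finset.mem_of_mem_erase hv))
      have hsum := Finset.add_sum_erase U p ht
      rw [hcard t ht, smul_eq_mul] at hle
      omega

/-- Stacking all pebbles on `v₀` needs at least `1 + 4 (|α v₀.1| - 1) + 2 ∑ i ≠ v₀.1, |α i|`
of them. -/
theorem le_of_wSolvable_completeMultipartiteGraph_single {ι : Type*} [Fintype ι] [DecidableEq ι]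
    {α : ι → Type*} [∀ i, Fintype (α i)] [∀ i, DecidableEq (α i)] (v₀ : Σ i, α i) {m : ℕ}
    (h : (completeMultipartiteGraph α).WSolvable (fun _ => 1) (Pi.single v₀ m)) :
    2 * Fintype.card (α v₀.1) + 2 * ∑ i, Fintype.card (α i) ≤ m + 3 := by
  set c : (Σ i, α i) → ℕ := fun v => if v = v₀ then 1 else if v.1 = v₀.1 then 4 else 2 with hc
  have hadj : ∀ u v, (completeMultipartiteGraph α).Adj u v → c v ≤ 2 * c u := by
    intro u v huv
    have huv : u.1 ≠ v.1 := huv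
    simp only [hc]
    grind
  have hle := h.sum_mul_le hadj
  have hm : ∑ x, c x * (Pi.single v₀ m : (Σ i, α i) → ℕ) x = m := by
    rw [Finset.sum_eq_single v₀ (fun x _ hx => by simp [hx]) (by simp)]
    simp [hc]
  have hcsum : ∑ x, (c x + if x = v₀ then 3 else 0) =
      ∑ x : Σ i, α i, (2 + if x.1 = v₀.1 then 2 else 0) := by
    refine Finset.sum_congr rfl fun x _ => ?_
    simp only [hc]
    grind
  have hparts : ∑ x : Σ i, α i, (if x.1 = v₀.1 then 2 else 0) = 2 * Fintype.card (α v₀.1) := by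
    rw [Fintype.sum_sigma, Finset.sum_eq_single v₀.1 (fun i _ hi => by simp [hi]) (by simp)]
    simp [mul_comm]
  rw [Finset.sum_add_distrib, Finset.sum_add_distrib, hparts] at hcsum
  simp only [Finset.sum_ite_eq', Finset.mem_univ, if_true, Finset.sum_const, Finset.card_univ,
    Fintype.card_sigma, smul_eq_mul] at hcsum
  simp only [mul_one, hm] at hle
  omega

end SimpleGraph

/-- The cover pebbling number of the complete multipartite graph with part sizes
`n 0 ≥ n 1 ≥ ⋯ ≥ n (k-1) ≥ 1` (with `k ≥ 2` parts) is
`4 * n 0 + 2 * n 1 + ⋯ + 2 * n (k-1) - 3`, i.e. `2 * n 0 + 2 * ∑ i, n i - 3`. -/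
theorem coverPebblingNumber_completeMultipartiteGraph (k : ℕ) (hk : 2 ≤ k)
    (n : Fin k → ℕ) (hmono : ∀ i j : Fin k, i ≤ j → n j ≤ n i) (hpos : ∀ i, 1 ≤ n i) :
    (SimpleGraph.completeMultipartiteGraph (fun i : Fin k => Fin (n i))).coverPebblingNumber
        (fun _ => 1) =
      2 * n ⟨0, by omega⟩ + 2 * ∑ i : Fin k, n i - 3 := by
  have : Nontrivial (Fin k) := Fin.nontrivial_iff_two_le.2 hk
  have hne : ∀ i, Nonempty (Fin (n i)) := fun i => ⟨⟨0, hpos i⟩⟩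
  refine IsLeast.csInf_eq ⟨fun p hp => ?_, fun m hm => ?_⟩
  · refine SimpleGraph.wSolvable_completeMultipartiteGraph_of_le Finset.univ p (by simp)
      fun i => ?_
    have hpart : (Finset.univ.filter fun v : Σ i : Fin k, Fin (n i) => v.1 = i).card = n i := by
      rw [Finset.card_filter, Fintype.sum_sigma,
        Finset.sum_eq_single i (fun j _ hj => by simp [hj]) (by simp)]
      simp
    have hi : n i ≤ n ⟨0, by omega⟩ := hmono _ _ (Nat.zero_le _)
    rw [hpart, hp, Finset.card_univ, Fintype.card_sigma]
    simp only [Fintype.card_fin]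
    omega
  · have h := SimpleGraph.le_of_wSolvable_completeMultipartiteGraph_single
      (α := fun i : Fin k => Fin (n i)) ⟨⟨0, by omega⟩, ⟨0, hpos _⟩⟩ (hm _ (Fintype.sum_pi_single' _ m))
    simp only [Fintype.card_fin] at h
    omega
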